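/- arXiv:math/9904129 — 3 statements merged into one kernel-verified Lean document; each statement's English description precedes it below -/
import Mathlib

section
/- Let L be a field and let v be an additive valuation on L with values in ℝ ∪ {∞} such that v(x) < ∞ for every x ≠ 0. Let M ≥ 0 be a real number, let g ∈ L[X] be a nonzero polynomial all of whose nonzero coefficients g_k satisfy |v(g_k)| ≤ M, and let ζ ∈ L be a nonzero root of g. Then |v(ζ)| ≤ 2M. -/
open Polynomial

/-- A nonzero root of a nonzero polynomial whose nonzero coefficients have valuation in `[-M, M]`
has valuation at most `2M`. -/
theorem AddValuation.root_le_of_coeff_bound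
    {L : Type*} [Field L] (v : AddValuation L (WithTop ℝ))
    (hfin : ∀ x : L, x ≠ 0 → v x ≠ ⊤) {M : ℝ} (hM : 0 ≤ M) {g : L[X]} (hg : g ≠ 0)
    (hcoeff : ∀ k : ℕ, g.coeff k ≠ 0 →
      ((-M : ℝ) : WithTop ℝ) ≤ v (g.coeff k) ∧ v (g.coeff k) ≤ ((M : ℝ) : WithTop ℝ))
    {ζ : L} (hζ : ζ ≠ 0) (hroot : g.eval ζ = 0) :
    v ζ ≤ ((2 * M : ℝ) : WithTop ℝ) := by
  by_contra! h
  obtain ⟨r, hr⟩ := WithTop.ne_top_iff_exists.mp (hfin ζ hζ)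
  rw [← hr, WithTop.coe_lt_coe] at h
  set m := g.natTrailingDegree with hm
  have hcm : g.coeff m ≠ 0 := mt trailingCoeff_eq_zero.mp hg
  have hterm : ∀ k, g.coeff k ≠ 0 → ∃ a : ℝ, -M ≤ a ∧ a ≤ M ∧
      v (g.coeff k * ζ ^ k) = ((a + k * r : ℝ) : WithTop ℝ) := by
    intro k hk
    obtain ⟨a, ha⟩ := WithTop.ne_top_iff_exists.mp (hfin _ hk)
    have hb := hcoeff k hk
    rw [← ha, WithTop.coe_le_coe, WithTop.coe_le_coe] at hb
    refine ⟨a, hb.1, hb.2, ?_⟩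
    rw [v.map_mul, v.map_pow, ← ha, ← hr, ← WithTop.coe_nsmul, ← WithTop.coe_add, nsmul_eq_mul]
  obtain ⟨a, -, haM, ha⟩ := hterm m hcm
  have hlt : v (g.coeff m * ζ ^ m) < v (∑ k ∈ g.support.erase m, g.coeff k * ζ ^ k) := by
    refine v.map_lt_sum (ha ▸ WithTop.coe_ne_top) fun k hk => ?_
    obtain ⟨hkm, hk⟩ := Finset.mem_erase.mp hk
    have hk := mem_support_iff.mp hk
    have hle : m + 1 ≤ k :=
      lt_of_le_of_ne (natTrailingDegree_le_of_ne_zero hk) hkm.symm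
    obtain ⟨b, hbM, -, hb⟩ := hterm k hk
    rw [ha, hb, WithTop.coe_lt_coe]
    have hle' : (m : ℝ) + 1 ≤ k := mod_cast hle
    nlinarith [mul_le_mul_of_nonneg_right hle' (by linarith : 0 ≤ r)]
  have hsum : g.coeff m * ζ ^ m + ∑ k ∈ g.support.erase m, g.coeff k * ζ ^ k = 0 := by
    rw [Finset.add_sum_erase _ (fun k => g.coeff k * ζ ^ k) (mem_support_iff.mpr hcm),
      ← hroot, eval_eq_sum, Polynomial.sum]
  rw [eq_neg_of_add_eq_zero_left hsum, v.map_neg] at hlt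
  exact hlt.false

/-- If every nonzero coefficient `g_k` of a nonzero polynomial `g` satisfies
`|v (g_k)| ≤ M`, then every nonzero root `ζ` of `g` satisfies `|v ζ| ≤ 2M`
(stated as `-2M ≤ v ζ ≤ 2M` in `WithTop ℝ`). -/
theorem root_valuation_bound_of_coeff_valuation_bound
    (L : Type*) [Field L] (v : AddValuation L (WithTop ℝ))
    (hfin : ∀ x : L, x ≠ 0 → v x ≠ ⊤)
    (M : ℝ) (hM : 0 ≤ M)
    (g : L[X]) (hg : g ≠ 0)
    (hcoeff : ∀ k : ℕ, g.coeff k ≠ 0 →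
      ((-M : ℝ) : WithTop ℝ) ≤ v (g.coeff k) ∧ v (g.coeff k) ≤ ((M : ℝ) : WithTop ℝ))
    (ζ : L) (hζ : ζ ≠ 0) (hroot : g.eval ζ = 0) :
    ((-(2 * M) : ℝ) : WithTop ℝ) ≤ v ζ ∧ v ζ ≤ ((2 * M : ℝ) : WithTop ℝ) := by
  refine ⟨?_, v.root_le_of_coeff_bound hfin hM hg hcoeff hζ hroot⟩
  have hrev : g.reverse.eval ζ⁻¹ = 0 := by
    let u : Invertible ζ := invertibleOfNonzero hζ
    have := (eval₂_reverse_eq_zero_iff (RingHom.id L) ζ g).mpr hroot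
    rwa [invOf_eq_inv] at this
  have hinv : v ζ⁻¹ ≤ ((2 * M : ℝ) : WithTop ℝ) := by
    refine v.root_le_of_coeff_bound hfin hM (mt reverse_eq_zero.mp hg) (fun k hk => ?_)
      (inv_ne_zero hζ) hrev
    rw [coeff_reverse] at hk ⊢
    exact hcoeff _ hk
  obtain ⟨r, hr⟩ := WithTop.ne_top_iff_exists.mp (hfin ζ hζ)
  obtain ⟨s, hs⟩ := WithTop.ne_top_iff_exists.mp (hfin ζ⁻¹ (inv_ne_zero hζ))
  have hrs : v ζ + v ζ⁻¹ = 0 := by rw [← v.map_mul, mul_inv_cancel₀ hζ, v.map_one]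
  rw [← hr, ← hs, ← WithTop.coe_add, WithTop.coe_eq_zero] at hrs
  rw [← hs, WithTop.coe_le_coe] at hinv
  rw [← hr, WithTop.coe_le_coe]
  linarith
end

section
/- Let N ≥ 1 be a natural number and let g ∈ ℚ[X] be a nonzero polynomial with g(2^N) = 0. Then g has a nonzero coefficient g_k with |ν₂(g_k)| ≥ N/2. -/
open Polynomial

/-- If `N ≥ 1` and `g ∈ ℚ[X]` is a nonzero polynomial with `g (2^N) = 0`,
then `g` has a nonzero coefficient `g_k` with `|ν₂ (g_k)| ≥ N / 2`. -/
theorem large_coeff_valuation_of_root_two_pow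
    (N : ℕ) (hN : 1 ≤ N)
    (g : Polynomial ℚ) (hg : g ≠ 0) (hroot : g.eval ((2 : ℚ) ^ N) = 0) :
    ∃ k : ℕ, g.coeff k ≠ 0 ∧ (N : ℝ) / 2 ≤ |(padicValRat 2 (g.coeff k) : ℝ)| := by
  by_contra! hsmall
  have hterm_ne (k : ℕ) (hk : g.coeff k ≠ 0) : g.coeff k * ((2 : ℚ) ^ N) ^ k ≠ 0 := by
    positivity
  have hval (k : ℕ) (hk : g.coeff k ≠ 0) :
      padicValRat 2 (g.coeff k * ((2 : ℚ) ^ N) ^ k) = padicValRat 2 (g.coeff k) + N * k := by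
    have htwo : padicValRat 2 (2 : ℚ) = 1 := by
      simpa using padicValRat.self (p := 2) (by norm_num)
    rw [padicValRat.mul hk (by positivity), ← pow_mul, padicValRat.pow, htwo]
    push_cast
    ring
  have hbound (k : ℕ) (hk : g.coeff k ≠ 0) :
      -(N : ℤ) < 2 * padicValRat 2 (g.coeff k) ∧ 2 * padicValRat 2 (g.coeff k) < N := by
    have h := abs_lt.mp (hsmall k hk)
    constructor
    · have : -(N : ℝ) < 2 * padicValRat 2 (g.coeff k) := by linarith
      exact_mod_cast this
    · have : 2 * (padicValRat 2 (g.coeff k) : ℝ) < N := by linarith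
      exact_mod_cast this
  set m := g.natTrailingDegree
  have hm : g.coeff m ≠ 0 := trailingCoeff_nonzero_iff_nonzero.mpr hg
  rw [eval_eq_sum, Polynomial.sum, ← Finset.add_sum_erase _ _ (mem_support_iff.mpr hm)] at hroot
  have hlt : padicNorm 2 (∑ k ∈ g.support.erase m, g.coeff k * ((2 : ℚ) ^ N) ^ k) <
      padicNorm 2 (g.coeff m * ((2 : ℚ) ^ N) ^ m) := by
    refine padicNorm.sum_lt' (fun k hk => ?_)
      ((padicNorm.nonneg _).lt_of_ne' (padicNorm.nonzero (hterm_ne m hm)))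
    obtain ⟨hkm, hk⟩ := Finset.mem_erase.mp hk
    have hmk : m < k := (natTrailingDegree_le_of_mem_supp k hk).lt_of_ne' hkm
    rw [mem_support_iff] at hk
    rw [padicNorm.eq_zpow_of_nonzero (hterm_ne k hk),
      padicNorm.eq_zpow_of_nonzero (hterm_ne m hm), hval k hk, hval m hm]
    refine zpow_lt_zpow_right₀ (by norm_num) (neg_lt_neg ?_)
    have hstep : (N : ℤ) * (m + 1) ≤ N * k :=
      mul_le_mul_of_nonneg_left (by exact_mod_cast hmk) (by positivity)
    linarith [(hbound k hk).1, (hbound m hm).2]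
  rw [eq_neg_of_add_eq_zero_left hroot, padicNorm.neg] at hlt
  exact lt_irrefl _ hlt
end

section
/- Let d ≥ 1 and let g ∈ ℚ[X] be a nonzero polynomial that vanishes at every point of the set X_d = {2^{2^{d·i}} : 0 ≤ i ≤ d}, i.e., g(2^{2^{d·i}}) = 0 for all 0 ≤ i ≤ d. Then g has a nonzero coefficient g_k with |ν₂(g_k)| ≥ 2^{d²}/2. In particular, deg g ≥ d + 1. -/
open Polynomial

/-- If the `p`-adic valuations of the nonzero coefficients of `g` pairwise differ by less than `N`,
then `p ^ N` is not a root of `g`: the lowest-degree term dominates. -/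
theorem eval_prime_pow_ne_zero_of_padicValRat_sub_lt (p : ℕ) [Fact p.Prime] (N : ℕ) (g : ℚ[X])
    (hg : g ≠ 0)
    (h : ∀ j k : ℕ, g.coeff j ≠ 0 → g.coeff k ≠ 0 →
      padicValRat p (g.coeff j) - padicValRat p (g.coeff k) < N) :
    g.eval ((p : ℚ) ^ N) ≠ 0 := by
  intro h0
  have hp : (p : ℚ) ≠ 0 := by exact_mod_cast (Fact.out : p.Prime).ne_zero
  have hp1 : (1 : ℚ) < p := by exact_mod_cast (Fact.out : p.Prime).one_lt
  set m := g.natTrailingDegree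
  have hcm : g.coeff m ≠ 0 := Polynomial.trailingCoeff_nonzero_iff_nonzero.mpr hg
  have hmem : m ∈ g.support := Polynomial.mem_support_iff.mpr hcm
  have hterm (k : ℕ) (hk : g.coeff k ≠ 0) :
      padicNorm p (g.coeff k * ((p : ℚ) ^ N) ^ k)
        = (p : ℚ) ^ (-(padicValRat p (g.coeff k) + N * k)) := by
    have hpow : ((p : ℚ) ^ N) ^ k ≠ 0 := pow_ne_zero _ (pow_ne_zero _ hp)
    rw [padicNorm.eq_zpow_of_nonzero (mul_ne_zero hk hpow), padicValRat.mul hk hpow, ← pow_mul,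
      padicValRat.pow, padicValRat.self (Fact.out : p.Prime).one_lt]
    push_cast
    ring_nf
  rw [Polynomial.eval_eq_sum, Polynomial.sum_def, ← Finset.add_sum_erase _ _ hmem] at h0
  have hlt : padicNorm p (∑ k ∈ g.support.erase m, g.coeff k * ((p : ℚ) ^ N) ^ k)
      < padicNorm p (g.coeff m * ((p : ℚ) ^ N) ^ m) := by
    refine padicNorm.sum_lt' (fun k hk => ?_) (by rw [hterm m hcm]; positivity)
    obtain ⟨hkm, hks⟩ := Finset.mem_erase.mp hk
    have hck := Polynomial.mem_support_iff.mp hks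
    have hmk : m + 1 ≤ k :=
      lt_of_le_of_ne (Polynomial.natTrailingDegree_le_of_ne_zero hck) (Ne.symm hkm)
    rw [hterm m hcm, hterm k hck]
    refine zpow_lt_zpow_right₀ hp1 ?_
    have hv := h m k hcm hck
    have hmul : (N : ℤ) * (m + 1) ≤ N * k := by exact_mod_cast Nat.mul_le_mul_left N hmk
    linarith
  rw [eq_neg_of_add_eq_zero_left h0, padicNorm.neg] at hlt
  exact lt_irrefl _ hlt

/-- If `d ≥ 1` and `g ∈ ℚ[X]` is a nonzero polynomial vanishing at every
point `2^(2^(d·i))` for `0 ≤ i ≤ d`, then `g` has a nonzero coefficient `g_k` with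
`|ν₂ (g_k)| ≥ 2^(d²) / 2`; in particular `deg g ≥ d + 1`. -/
theorem large_coeff_valuation_of_vanishing_on_Xd
    (d : ℕ) (hd : 1 ≤ d)
    (g : Polynomial ℚ) (hg : g ≠ 0)
    (hroots : ∀ i : ℕ, i ≤ d → g.eval ((2 : ℚ) ^ (2 ^ (d * i))) = 0) :
    (∃ k : ℕ, g.coeff k ≠ 0 ∧
      (2 : ℝ) ^ (d * d) / 2 ≤ |(padicValRat 2 (g.coeff k) : ℝ)|) ∧
    d + 1 ≤ g.natDegree := by
  constructor
  · by_contra! hsmall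
    refine eval_prime_pow_ne_zero_of_padicValRat_sub_lt 2 (2 ^ (d * d)) g hg
      (fun j k hj hk => ?_) (by exact_mod_cast hroots d le_rfl)
    have h1 := (abs_lt.mp (hsmall j hj)).2
    have h2 := (abs_lt.mp (hsmall k hk)).1
    have h3 : (padicValRat 2 (g.coeff j) : ℝ) - padicValRat 2 (g.coeff k) < 2 ^ (d * d) := by
      linarith
    exact_mod_cast h3
  · have hinj : Function.Injective fun i : ℕ => (2 : ℚ) ^ (2 ^ (d * i)) := fun i j hij =>
      Nat.eq_of_mul_eq_mul_left hd <| Nat.pow_right_injective le_rfl <|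
        pow_right_injective₀ (by norm_num : (0 : ℚ) < 2) (by norm_num) hij
    have hsub : ((Finset.range (d + 1)).image fun i : ℕ => (2 : ℚ) ^ (2 ^ (d * i))).val
        ⊆ g.roots := by
      intro x hx
      obtain ⟨i, hi, rfl⟩ := Finset.mem_image.mp (Finset.mem_val.mp hx)
      exact (Polynomial.mem_roots hg).mpr
        (hroots i (Nat.lt_succ_iff.mp (Finset.mem_range.mp hi)))
    simpa [Finset.card_image_of_injective _ hinj] using
      Polynomial.card_le_degree_of_subset_roots hsub
end
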